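/- Let k > ℓ ≥ 1 with 0 ≤ λ ≤ k+ℓ−5, let p = (k+ℓ)m+2+λ be prime with m ≥ 5, and let n ≥ 1. Suppose A ⊆ F_p^n is a (k,ℓ)-sum-free set with |A| ≥ m·p^{n−1}. Then for every decomposition (v,K) of F_p^n, either ω(A) ≤ m+1 or ω(A) > p − θ, where θ = k+ℓ+λ+2. -/

import Mathlib

open Pointwise

/-- `itSum h A` is the `h`-fold sumset `hA = A + ⋯ + A` (`h` copies), with `itSum 0 A = {0}`. -/
def itSum {G : Type*} [AddCommMonoid G] : ℕ → Set G → Set G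
  | 0, _ => {0}
  | h + 1, A => itSum h A + A

/-- `A` is `(k,ℓ)`-sum-free: the sumsets `kA` and `ℓA` are disjoint. -/
def KLFree {G : Type*} [AddCommMonoid G] (k l : ℕ) (A : Set G) : Prop :=
  itSum k A ∩ itSum l A = ∅

/-- The interval `[a, a+t] = {a, a+1, …, a+t}` in `ZMod p`. -/
def Ival {p : ℕ} (a : ZMod p) (t : ℕ) : Set (ZMod p) :=
  {x | ∃ i : ℕ, i ≤ t ∧ x = a + (i : ZMod p)}

/-- The cuboid `[a, a+t] × F_p^{n'}` inside the model space `F_p × F_p^{n'}`. -/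
def cub (p n' : ℕ) (a : ZMod p) (t : ℕ) : Set (ZMod p × (Fin n' → ZMod p)) :=
  {x | x.1 ∈ Ival a t}

/-- The element `a_j = -(km+1+j)·(k-ℓ)⁻¹` of `F_p`. -/
def ajElt (k l m p j : ℕ) : ZMod p :=
  -((k * m + 1 + j : ℕ) : ZMod p) * (((k - l : ℕ) : ZMod p))⁻¹

/-- The layer `A_i = (A - i·v) ∩ K` of `A` w.r.t. the decomposition `(v, K)`. -/
def layerKL {p n : ℕ} (v : Fin n → ZMod p) (K : Submodule (ZMod p) (Fin n → ZMod p))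
    (A : Set (Fin n → ZMod p)) (i : ZMod p) : Set (Fin n → ZMod p) :=
  {x | x ∈ K ∧ x + i • v ∈ A}

/-- The support `Supp(A) = {i | A_i ≠ ∅}` w.r.t. the decomposition `(v, K)`. -/
def supp {p n : ℕ} (v : Fin n → ZMod p) (K : Submodule (ZMod p) (Fin n → ZMod p))
    (A : Set (Fin n → ZMod p)) : Set (ZMod p) :=
  {i | (layerKL v K A i).Nonempty}

/-- The weight `ω(A) = |Supp(A)|` w.r.t. the decomposition `(v, K)`. -/
noncomputable def weight {p n : ℕ} (v : Fin n → ZMod p)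
    (K : Submodule (ZMod p) (Fin n → ZMod p)) (A : Set (Fin n → ZMod p)) : ℕ :=
  (supp v K A).ncard

/-- `A ⊆ F_p^n` is trivial: isomorphic to a subset of some extremal cuboid `A_{k,ℓ,p,j}`. -/
def IsTrivialKL (k l m lam p n : ℕ) (A : Set (Fin n → ZMod p)) : Prop :=
  ∃ (e : (Fin n → ZMod p) ≃+ (ZMod p × (Fin (n - 1) → ZMod p))) (j : ℕ),
    j < (lam + 2) / 2 ∧ e '' A ⊆ cub p (n - 1) (ajElt k l m p j) m

/-- Type 1. -/
def IsType1 (k l m lam p n : ℕ) (A : Set (Fin n → ZMod p)) : Prop :=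
  A.ncard = m * p ^ (n - 1) ∧
  ∃ (e : (Fin n → ZMod p) ≃+ (ZMod p × (Fin (n - 1) → ZMod p))) (a : ZMod p),
    ((l : ZMod p) * a - (k : ZMod p) * (a + (m : ZMod p) - 1) ∈ Ival (1 : ZMod p) (l - 1) ∨
      (lam + l + 2 ≤ k ∧
        (l : ZMod p) * a - (k : ZMod p) * (a + (m : ZMod p) - 1) ∈
          Ival ((lam + l + 2 : ℕ) : ZMod p) (k - (lam + l + 2)))) ∧
    e '' A = cub p (n - 1) a (m - 1)

/-- The element `a = m·k·(ℓ-k)⁻¹` of `F_p` used in type 2. -/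
def type2a (k l m p : ℕ) : ZMod p :=
  (m : ZMod p) * (k : ZMod p) * (((l : ZMod p) - (k : ZMod p))⁻¹)

/-- Type 2. -/
def IsType2 (k l m p n : ℕ) (A : Set (Fin n → ZMod p)) : Prop :=
  l = 1 ∧ 2 ≤ n ∧ A.ncard = m * p ^ (n - 1) ∧
  ∃ (e : (Fin n → ZMod p) ≃+ (ZMod p × (Fin (n - 1) → ZMod p)))
      (V : Submodule (ZMod p) (Fin (n - 1) → ZMod p)),
    V ≠ ⊤ ∧
    e '' A =
      ({type2a k l m p} ×ˢ (Set.univ \ (V : Set (Fin (n - 1) → ZMod p)))) ∪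
        ((Ival (type2a k l m p + 1) (m - 2)) ×ˢ (Set.univ : Set (Fin (n - 1) → ZMod p))) ∪
        ({type2a k l m p + (m : ZMod p)} ×ˢ (V : Set (Fin (n - 1) → ZMod p)))

/-- Normal: of type 1 or type 2. -/
def IsNormalKL (k l m lam p n : ℕ) (A : Set (Fin n → ZMod p)) : Prop :=
  IsType1 k l m lam p n A ∨ IsType2 k l m p n A

/-- The element `a = (ℓm+k-1)·(k-ℓ)⁻¹` of `F_p` used in type 3. -/
def type3a (k l m p : ℕ) : ZMod p :=
  ((l * m + k - 1 : ℕ) : ZMod p) * (((k - l : ℕ) : ZMod p))⁻¹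

/-- Type 3. -/
def IsType3 (k l m p n : ℕ) (A : Set (Fin n → ZMod p)) : Prop :=
  A.ncard = m * p ^ (n - 1) ∧
  ∃ e : (Fin n → ZMod p) ≃+ (ZMod p × (Fin (n - 1) → ZMod p)),
    e '' A = {x | x.1 ∈ Ival (type3a k l m p - 1) (m + 1) \
      {type3a k l m p, type3a k l m p + (m : ZMod p) - 1}}

/-- Type 4 (for `p = 5m+3`). -/
def IsType4 (m p n : ℕ) (A : Set (Fin n → ZMod p)) : Prop :=
  2 ≤ n ∧ A.ncard = m * p ^ (n - 1) ∧
  ∃ (e : (Fin n → ZMod p) ≃+ (ZMod p × (Fin (n - 1) → ZMod p)))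
      (V : Submodule (ZMod p) (Fin (n - 1) → ZMod p)),
    V ≠ ⊤ ∧
    e '' A =
      (({((2 * m + 1 : ℕ) : ZMod p), ((3 * m + 2 : ℕ) : ZMod p)} : Set (ZMod p)) ×ˢ
          (V : Set (Fin (n - 1) → ZMod p))) ∪
        (({((2 * m + 2 : ℕ) : ZMod p), ((3 * m + 1 : ℕ) : ZMod p)} : Set (ZMod p)) ×ˢ
          (Set.univ \ (V : Set (Fin (n - 1) → ZMod p)))) ∪
        ((Ival ((2 * m + 3 : ℕ) : ZMod p) (m - 3)) ×ˢ (Set.univ : Set (Fin (n - 1) → ZMod p)))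

/-- The set `A₀ ⊆ F_p × F_p^s` used in type 5 (for `p = 4m+3`), with `a = (m+2)/2`. -/
def type5A0 (m p s : ℕ) (P : Set (Fin s → ZMod p)) : Set (ZMod p × (Fin s → ZMod p)) :=
  {(((m + 2 : ℕ) : ZMod p) * (2 : ZMod p)⁻¹ - 1, (0 : Fin s → ZMod p))} ∪
    ({((m + 2 : ℕ) : ZMod p) * (2 : ZMod p)⁻¹} ×ˢ (Set.univ \ P)) ∪
    ((Ival (((m + 2 : ℕ) : ZMod p) * (2 : ZMod p)⁻¹ + 1) (m - 3)) ×ˢ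
      (Set.univ : Set (Fin s → ZMod p))) ∪
    ({((m + 2 : ℕ) : ZMod p) * (2 : ZMod p)⁻¹ + (m : ZMod p) - 1} ×ˢ
      (Set.univ \ {(0 : Fin s → ZMod p)})) ∪
    ({((m + 2 : ℕ) : ZMod p) * (2 : ZMod p)⁻¹ + (m : ZMod p)} ×ˢ P)

/-- Type 5 (for `p = 4m+3`). -/
def IsType5 (m p n : ℕ) (A : Set (Fin n → ZMod p)) : Prop :=
  A.ncard = m * p ^ (n - 1) ∧
  ∃ s : ℕ, s ≤ n - 1 ∧
    ∃ (e : (Fin n → ZMod p) ≃+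
          (ZMod p × (Fin s → ZMod p) × (Fin (n - 1 - s) → ZMod p)))
      (P : Set (Fin s → ZMod p)),
      P.Nonempty ∧ (0 : Fin s → ZMod p) ∉ itSum 3 P ∧
      e '' A = {x | (x.1, x.2.1) ∈ type5A0 m p s P}

/-- `τ` is feasible for `c`. -/
def Feasible (c τ : ℝ) : Prop :=
  ∀ q : ℕ, q.Prime → ∀ B : Set (ZMod q),
    (B.ncard : ℝ) ≤ c * q →
    ((B + B).ncard : ℝ) ≤ (2 + τ) * (B.ncard : ℝ) - 3 →
    ∃ y d : ZMod q, d ≠ 0 ∧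
      B ⊆ {x | ∃ i : ℕ, i ≤ (B + B).ncard - B.ncard ∧ x = y + (i : ZMod q) * d}

open Finset in
/-- A weak form of Kneser's theorem, proved with Dyson's e-transform. -/
lemma card_add_of_zero_mem {G : Type*} [AddCommGroup G] [Fintype G] [DecidableEq G] (p : ℕ)
    (hG : ∀ H : AddSubgroup G, H ≠ ⊤ → p * Nat.card H ≤ Fintype.card G) (N : ℕ) :
    ∀ A B : Finset G, #B ≤ N → A.Nonempty → 0 ∈ B →
      A + B = univ ∨ p * (#A + #B) ≤ p * #(A + B) + Fintype.card G := by
  induction N with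
  | zero =>
    intro A B hB _ h0
    exact absurd (card_pos.2 ⟨0, h0⟩) (by omega)
  | succ N ih =>
    intro A B hB hA h0
    have hAB : A ⊆ A + B := fun a ha => by simpa using add_mem_add ha h0
    by_cases hst : ∀ e ∈ A, ∀ b ∈ B, e + b ∈ A
    · have hper : ∀ x ∈ AddSubgroup.closure (B : Set G), ∀ a, a + x ∈ A ↔ a ∈ A := by
        intro x hx
        induction hx using AddSubgroup.closure_induction with
        | mem b hb =>
          intro a
          have himg : A.image (· + b) = A := by
            apply eq_of_subset_of_card_le
            · intro y hy
              obtain ⟨c, hc, rfl⟩ := mem_image.1 hy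
              exact hst c hc b hb
            · rw [card_image_of_injective _ (add_left_injective b)]
          constructor
          · intro h
            rw [← himg] at h
            obtain ⟨c, hc, hcb⟩ := mem_image.1 h
            rwa [← add_right_cancel hcb]
          · intro h
            exact hst a h b hb
        | zero => simp
        | add x y _ _ hx hy => intro a; rw [← add_assoc, hy, hx]
        | neg x _ hx => intro a; rw [← hx, neg_add_cancel_right]
      by_cases htop : AddSubgroup.closure (B : Set G) = ⊤
      · left
        obtain ⟨a, ha⟩ := hA
        refine eq_univ_of_forall fun y => hAB ?_
        have := (hper (y - a) (by simp [htop]) a).2 ha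
        simpa using this
      · right
        have h1 := hG _ htop
        have h2 : #B ≤ Nat.card (AddSubgroup.closure (B : Set G)) := by
          have h := Nat.card_mono (Set.toFinite _) (AddSubgroup.subset_closure (k := (B : Set G)))
          simpa using h
        have h3 := card_le_card hAB
        have h4 := Nat.mul_le_mul_left p h2
        have h5 := Nat.mul_le_mul_left p h3
        rw [mul_add]
        omega
    · push Not at hst
      obtain ⟨e, he, b, hb, heb⟩ := hst
      have hcap : #(A ∩ B.image (e + ·)) = #(B.filter (e + · ∈ A)) := by
        rw [← card_image_of_injective (B.filter (e + · ∈ A)) (add_right_injective e)]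
        congr 1
        ext y
        simp only [mem_inter, mem_image, mem_filter]
        constructor
        · rintro ⟨hy, c, hc, rfl⟩
          exact ⟨c, ⟨hc, hy⟩, rfl⟩
        · rintro ⟨c, ⟨hc, hy⟩, rfl⟩
          exact ⟨hy, c, hc, rfl⟩
      have hcard : #(A ∪ B.image (e + ·)) + #(B.filter (e + · ∈ A)) = #A + #B := by
        rw [← hcap, card_union_add_card_inter, card_image_of_injective _ (add_right_injective e)]
      have hsub : (A ∪ B.image (e + ·)) + B.filter (e + · ∈ A) ⊆ A + B := by
        intro y hy
        obtain ⟨c, hc, d, hd, rfl⟩ := mem_add.1 hy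
        rw [mem_filter] at hd
        rcases mem_union.1 hc with hc | hc
        · exact add_mem_add hc hd.1
        · obtain ⟨c, hcB, rfl⟩ := mem_image.1 hc
          rw [add_right_comm]
          exact add_mem_add hd.2 hcB
      have hlt : #(B.filter (e + · ∈ A)) < #B :=
        card_lt_card (filter_ssubset.2 ⟨b, hb, heb⟩)
      rcases ih (A ∪ B.image (e + ·)) (B.filter (e + · ∈ A)) (by omega)
        (hA.mono subset_union_left) (by simp [h0, he]) with h | h
      · left
        exact univ_subset_iff.1 (h ▸ hsub)
      · right
        rw [hcard] at h
        exact h.trans (Nat.add_le_add_right (Nat.mul_le_mul_left p (card_le_card hsub)) _)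

open Finset in
lemma card_add_of_proper_subgroups {G : Type*} [AddCommGroup G] [Fintype G] [DecidableEq G] (p : ℕ)
    (hG : ∀ H : AddSubgroup G, H ≠ ⊤ → p * Nat.card H ≤ Fintype.card G)
    {A B : Finset G} (hA : A.Nonempty) (hB : B.Nonempty) :
    A + B = univ ∨ p * (#A + #B) ≤ p * #(A + B) + Fintype.card G := by
  obtain ⟨b, hb⟩ := hB
  have key := card_add_of_zero_mem p hG _ (A + {b}) (B + {-b}) le_rfl
    (hA.add (singleton_nonempty b)) (mem_add.2 ⟨b, hb, -b, by simp, by simp⟩)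
  have hsum : (A + {b}) + (B + {-b}) = A + B := by
    rw [add_add_add_comm, singleton_add_singleton, add_neg_cancel, singleton_zero, add_zero]
  rwa [hsum, card_add_singleton, card_add_singleton] at key

open Finset in
lemma card_sum_of_proper_subgroups {G ι : Type*} [AddCommGroup G] [Fintype G] [DecidableEq G]
    (p : ℕ) (hG : ∀ H : AddSubgroup G, H ≠ ⊤ → p * Nat.card H ≤ Fintype.card G)
    (S : ι → Finset G) {J : Finset ι} (hJ : J.Nonempty) (hS : ∀ j ∈ J, (S j).Nonempty) :
    ∑ j ∈ J, S j = univ ∨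
      p * ∑ j ∈ J, #(S j) + Fintype.card G ≤ p * #(∑ j ∈ J, S j) + #J * Fintype.card G := by
  suffices h : (∑ j ∈ J, S j).Nonempty ∧ (∑ j ∈ J, S j = univ ∨
      p * ∑ j ∈ J, #(S j) + Fintype.card G ≤ p * #(∑ j ∈ J, S j) + #J * Fintype.card G) from h.2
  induction hJ using Finset.Nonempty.cons_induction with
  | singleton a => simpa using hS
  | cons a J ha hJ ih =>
    obtain ⟨hne, ih⟩ := ih fun j hj => hS j (mem_cons_of_mem hj)
    have hSa := hS a (mem_cons_self a J)
    rw [sum_cons, sum_cons, card_cons]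
    refine ⟨hSa.add hne, ?_⟩
    rcases ih with ih | ih
    · left
      obtain ⟨c, hc⟩ := hSa
      rw [ih]
      exact eq_univ_of_forall fun y => mem_add.2 ⟨c, hc, y - c, mem_univ _, by abel⟩
    · rcases card_add_of_proper_subgroups p hG hSa hne with h | h
      · exact Or.inl h
      · right
        rw [mul_add] at h
        rw [mul_add, add_mul]
        omega

lemma proper_addSubgroup_card_le {p : ℕ} [Fact p.Prime] {G : Type*} [AddCommGroup G]
    [Module (ZMod p) G] [Fintype G] (H : AddSubgroup G) (hH : H ≠ ⊤) :
    p * Nat.card H ≤ Fintype.card G := by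
  have hcard : Fintype.card G = p ^ Module.finrank (ZMod p) G := by
    rw [Module.card_eq_pow_finrank (K := ZMod p), ZMod.card]
  have hmul := H.card_mul_index
  rw [Nat.card_eq_fintype_card (α := G)] at hmul
  have hdvd : H.index ∣ p ^ Module.finrank (ZMod p) G := hcard ▸ hmul ▸ Dvd.intro_left _ rfl
  obtain ⟨i, -, hi⟩ := (Nat.dvd_prime_pow Fact.out).1 hdvd
  have hi0 : i ≠ 0 := by
    rintro rfl
    exact hH (AddSubgroup.index_eq_one.1 (by simpa using hi))
  rw [← hmul, mul_comm, hi]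
  exact Nat.mul_le_mul_left _ (Nat.le_self_pow hi0 p)

open Finset in
/-- If the layers `C j i` admit no zero-sum transversal over a zero-sum choice of indices, then
large index sets `X j` force small layers. -/
lemma layer_sizes_of_zero_sum_free {p : ℕ} [Fact p.Prime] {G : Type*} [AddCommGroup G]
    [Module (ZMod p) G] [Fintype G] {r s : ℕ} (hs : 1 ≤ s) (hsr : s ≤ r)
    (C : ℕ → ZMod p → Finset G)
    (hfree : ∀ (f : ℕ → ZMod p) (x : ℕ → G), (∀ j < r, x j ∈ C j (f j)) →
      ∑ j ∈ range r, f j = 0 → ∑ j ∈ range r, x j ≠ 0)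
    (X : ℕ → Finset (ZMod p)) (β : ℕ → ℕ) (hX : ∀ j < r, (X j).Nonempty)
    (hC : ∀ j < r, ∀ i ∈ X j, (C j i).Nonempty)
    (hβ : ∀ j < r, ∀ i ∈ X j, β j ≤ #(C j i))
    (hsum : p + r ≤ ∑ j ∈ range r, #(X j) + 1) :
    p * ∑ j ∈ range s, β j + Fintype.card G < (p + s) * Fintype.card G := by
  classical
  have hp : 0 < p := (Fact.out : p.Prime).pos
  have hXu : ∑ j ∈ range r, X j = univ := by
    rcases card_sum_of_proper_subgroups p (G := ZMod p) proper_addSubgroup_card_le X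
      (J := range r) (nonempty_range_iff.2 (by omega)) (fun j hj => hX j (mem_range.1 hj))
      with h | h
    · exact h
    · rw [ZMod.card, card_range, mul_comm r p, ← mul_add_one, ← mul_add] at h
      have h' := Nat.le_of_mul_le_mul_left h hp
      apply eq_univ_of_card
      have := card_le_univ (∑ j ∈ range r, X j)
      rw [ZMod.card] at this ⊢
      omega
  have h0 : (0 : ZMod p) ∈ ((∑ j ∈ range r, X j : Finset (ZMod p)) : Set (ZMod p)) := by
    simp [hXu]
  rw [coe_sum, Set.mem_finsetSum] at h0
  obtain ⟨f, hf, hf0⟩ := h0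
  have hfX : ∀ j < r, f j ∈ X j := fun j hj => hf (mem_range.2 hj)
  choose! y hy using fun j hj => hC j hj (f j) (hfX j hj)
  have hne : ∑ j ∈ range s, C j (f j) ≠ univ := by
    intro hu
    have h1 : -∑ j ∈ Ico s r, y j ∈ ((∑ j ∈ range s, C j (f j) : Finset G) : Set G) := by
      simp [hu]
    rw [coe_sum, Set.mem_finsetSum] at h1
    obtain ⟨x, hx, hxs⟩ := h1
    refine hfree f (fun j => if j < s then x j else y j) (fun j hj => ?_) hf0 ?_
    · by_cases hjs : j < s
      · simpa [hjs] using hx (mem_range.2 hjs)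
      · simpa [hjs] using hy j hj
    · rw [← sum_range_add_sum_Ico _ hsr,
        sum_congr rfl (fun j hj => if_pos (mem_range.1 hj)),
        sum_congr rfl (fun j hj => if_neg (not_lt.2 (mem_Ico.1 hj).1)), hxs, neg_add_cancel]
  have hlt : #(∑ j ∈ range s, C j (f j)) < Fintype.card G := (card_lt_iff_ne_univ _).2 hne
  rcases card_sum_of_proper_subgroups p (G := G) proper_addSubgroup_card_le (fun j => C j (f j))
    (J := range s) (nonempty_range_iff.2 (by omega))
    (fun j hj => ⟨_, hy j ((mem_range.1 hj).trans_le hsr)⟩) with h | h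
  · exact absurd h hne
  · have h1 : ∑ j ∈ range s, β j ≤ ∑ j ∈ range s, #(C j (f j)) := sum_le_sum fun j hj =>
      have hjr := (mem_range.1 hj).trans_le hsr
      hβ j hjr _ (hfX j hjr)
    have h2 := Nat.mul_le_mul_left p h1
    have h3 := Nat.mul_lt_mul_of_pos_left hlt hp
    rw [card_range] at h
    rw [add_mul]
    omega

open Finset in
lemma exists_sorted_enumeration {α : Type*} (g : α → ℕ) (d : α) (N : ℕ) :
    ∀ W : Finset α, #W = N → ∃ σ : ℕ → α, Set.InjOn σ (range N) ∧
      (∀ i < N, σ i ∈ W) ∧ ∀ i j, i ≤ j → j < N → g (σ j) ≤ g (σ i) := by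
  classical
  induction N with
  | zero => intro W _; exact ⟨fun _ => d, by simp⟩
  | succ N ih =>
    intro W hW
    obtain ⟨x, hx, hmin⟩ := exists_min_image W g (card_pos.1 (by omega))
    obtain ⟨σ, hinj, hmem, hanti⟩ := ih (W.erase x) (by rw [card_erase_of_mem hx]; omega)
    refine ⟨fun i => if i < N then σ i else x, ?_, ?_, ?_⟩
    · intro i hi j hj hij
      simp only [coe_range, Set.mem_Iio] at hi hj
      dsimp only at hij
      split_ifs at hij with h1 h2 h2
      · exact hinj (by simpa using h1) (by simpa using h2) hij
      · exact absurd hij (ne_of_mem_erase (hmem i h1))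
      · exact absurd hij.symm (ne_of_mem_erase (hmem j h2))
      · omega
    · intro i hi
      dsimp only
      split_ifs with h
      · exact mem_of_mem_erase (hmem i h)
      · exact hx
    · intro i j hij hj
      dsimp only
      split_ifs with h1 h2 h2
      · exact hanti i j hij h1
      · omega
      · exact hmin _ (mem_of_mem_erase (hmem i h2))
      · exact le_rfl

open Finset in
lemma sum_range_comp_eq {b f : ℕ → ℕ} {N : ℕ} (hmaps : ∀ t < N, f t < N)
    (hinj : ∀ t < N, ∀ t' < N, f t = f t' → t = t') :
    ∑ t ∈ range N, b (f t) = ∑ t ∈ range N, b t := by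
  have hi : Set.InjOn f (range N) := fun t ht t' ht' h =>
    hinj t (by simpa using ht) t' (by simpa using ht') h
  have himg : (range N).image f = range N := by
    apply eq_of_subset_of_card_le
    · intro y hy
      obtain ⟨t, ht, rfl⟩ := mem_image.1 hy
      exact mem_range.2 (hmaps t (mem_range.1 ht))
    · rw [card_image_of_injOn hi]
  rw [← sum_image hi (f := b), himg]

open Finset in
/-- For `s ≠ 1` there are `s` permutations of `{0, …, u}` whose pointwise sum is everywhere at
least the integer part of its mean `s * u / 2`. -/
lemma exists_balanced_permutations (u s : ℕ) (hs : s ≠ 1) : ∃ π : ℕ → ℕ → ℕ,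
    (∀ j < s, (∀ t < u + 1, π j t < u + 1) ∧
      ∀ t < u + 1, ∀ t' < u + 1, π j t = π j t' → t = t') ∧
    ∀ t < u + 1, s * u / 2 ≤ ∑ j ∈ range s, π j t := by
  induction s using Nat.strong_induction_on with
  | _ s ih =>
    obtain rfl | rfl | hs' : s = 0 ∨ s = 3 ∨ (2 ≤ s ∧ s - 2 ≠ 1) := by omega
    · exact ⟨fun _ t => t, by simp⟩
    · refine ⟨fun j t => if j = 0 then t else if j = 1 then
        (if 2 * t ≤ u then t + (u + 1) / 2 else t - u / 2 - 1)
        else (if 2 * t ≤ u then u / 2 * 2 - 2 * t else 2 * u + 1 - 2 * t), ?_, ?_⟩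
      · intro j hj
        refine ⟨fun t ht => ?_, fun t ht t' ht' h => ?_⟩
        · dsimp only
          split_ifs <;> omega
        · dsimp only at h
          split_ifs at h <;> omega
      · intro t ht
        simp only [sum_range_succ, sum_range_zero]
        norm_num
        split_ifs <;> omega
    · obtain ⟨s, rfl⟩ : ∃ s', s = s' + 2 := ⟨s - 2, by omega⟩
      obtain ⟨π, hπ, hsum⟩ := ih s (by omega) (by omega)
      refine ⟨fun j t => if j < s then π j t else if j = s then t else u - t, ?_, ?_⟩
      · intro j hj
        by_cases h1 : j < s
        · simpa [h1] using hπ j h1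
        · by_cases h2 : j = s
          · simp [h2]
          · simp only [h1, h2, if_false]
            constructor <;> intros <;> omega
      · intro t ht
        have h1 := hsum t ht
        rw [sum_range_succ, sum_range_succ, sum_congr rfl (fun j hj => if_pos (mem_range.1 hj))]
        simp only [lt_irrefl, if_true, if_false]
        have h2 : ¬ s + 1 < s := by omega
        have h3 : s + 1 ≠ s := by omega
        simp only [h2, h3, if_false]
        have h4 : (s + 2) * u = s * u + 2 * u := by ring
        omega

open Finset in
lemma mean_bound {p q r u s : ℕ} {b : ℕ → ℕ} (hs : 2 ≤ s)
    (htup : ∀ idx : ℕ → ℕ, (∀ j < s, idx j ≤ u) →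
      p ≤ ∑ j ∈ range s, idx j + (r - s) * u + 1 →
      p * ∑ j ∈ range s, b (idx j) + q < (p + s) * q)
    (hlarge : p ≤ s * u / 2 + (r - s) * u + 1) :
    p * (s * ∑ i ∈ range (u + 1), b i) + (u + 1) * q ≤ (u + 1) * ((p + s) * q) := by
  obtain ⟨π, hπ, hsum⟩ := exists_balanced_permutations u s (by omega)
  have h1 : ∀ t ∈ range (u + 1), p * ∑ j ∈ range s, b (π j t) + q ≤ (p + s) * q := by
    intro t ht
    rw [mem_range] at ht
    refine (htup (fun j => π j t) (fun j hj => Nat.lt_succ_iff.1 ((hπ j hj).1 t ht)) ?_).le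
    have := hsum t ht
    omega
  have h2 := sum_le_sum h1
  rw [sum_add_distrib, ← mul_sum, sum_comm,
    sum_congr rfl (fun j hj => sum_range_comp_eq (hπ j (mem_range.1 hj)).1
      (hπ j (mem_range.1 hj)).2)] at h2
  simpa using h2

open Finset in
/-- The extremal problem for the sorted layer sizes `b 0 ≥ b 1 ≥ … ≥ b u`. -/
lemma no_intermediate_weight {p q r u m lam : ℕ} {b : ℕ → ℕ} (hr : lam + 5 ≤ r) (hm : 5 ≤ m)
    (hp : p = r * m + 2 + lam) (hq : 0 < q) (hu1 : m + 1 ≤ u) (hu2 : u + 1 ≤ r * (m - 1))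
    (hbq : ∀ i, b i ≤ q) (hsum : m * q ≤ ∑ i ∈ range (u + 1), b i)
    (htup : ∀ s, 1 ≤ s → s ≤ r → ∀ idx : ℕ → ℕ, (∀ j < s, idx j ≤ u) →
      p ≤ ∑ j ∈ range s, idx j + (r - s) * u + 1 →
      p * ∑ j ∈ range s, b (idx j) + q < (p + s) * q) : False := by
  have hmean : ∀ s, 2 ≤ s → s ≤ r → p ≤ s * u / 2 + (r - s) * u + 1 →
      p * (s * m) + (u + 1) ≤ (u + 1) * (p + s) := by
    intro s hs hsr hl
    have h := mean_bound hs (htup s (by omega) hsr) hl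
    have h2 := Nat.mul_le_mul_left (p * s) hsum
    refine Nat.le_of_mul_le_mul_right ?_ hq
    nlinarith
  obtain ⟨m, rfl⟩ : ∃ m', m = m' + 5 := ⟨m - 5, by omega⟩
  obtain ⟨r, rfl⟩ : ∃ r', r = r' + 5 + lam := ⟨r - 5 - lam, by omega⟩
  rw [show m + 5 - 1 = m + 4 by omega] at hu2
  by_cases hA : 2 * m + 12 ≤ u
  · have h := hmean (r + 5 + lam) (by omega) le_rfl (by
      have h1 := Nat.mul_le_mul_left (r + 5 + lam) hA
      rw [Nat.sub_self]
      have h2 : (r + 5 + lam) * (m + 6) ≤ (r + 5 + lam) * u / 2 := by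
        rw [Nat.le_div_iff_mul_le (by norm_num)]
        nlinarith
      rw [hp]
      nlinarith)
    have h3 := Nat.mul_le_mul_right (p + (r + 5 + lam) - 1) hu2
    have h4 : (u + 1) * (p + (r + 5 + lam) - 1) + (u + 1) = (u + 1) * (p + (r + 5 + lam)) := by
      rw [← mul_add_one]
      congr 1
      omega
    have h5 : p * ((r + 5 + lam) * (m + 5)) ≤
        (r + 5 + lam) * (m + 4) * (p + (r + 5 + lam) - 1) := by omega
    rw [show p + (r + 5 + lam) - 1 = p + (r + 4 + lam) by omega] at h5
    have h6 : (r + 5 + lam) * (p * (m + 5)) ≤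
        (r + 5 + lam) * ((m + 4) * (p + (r + 4 + lam))) := by linarith
    have h7 := Nat.le_of_mul_le_mul_left h6 (by omega)
    nlinarith
  · by_cases hB : 2 * m + 9 ≤ u
    · have h := hmean 4 (by omega) (by omega) (by
        rw [show 4 * u / 2 = 2 * u by omega, show r + 5 + lam - 4 = r + 1 + lam by omega, hp]
        have h1 := Nat.mul_le_mul_left (r + 3 + lam) hB
        nlinarith)
      have hu : u + 1 ≤ 2 * m + 12 := by omega
      have h3 := Nat.mul_le_mul_right (p + 3) hu
      have h4 : p ≥ 5 * m + 27 := by rw [hp]; nlinarith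
      nlinarith
    · have hp' : 2 * m + 9 < p := by rw [hp]; nlinarith
      by_cases hc : p ≤ 2 * u / 2 + (r + 5 + lam - 2) * u + 1
      · have h := hmean 2 (by omega) (by omega) hc
        have hu : u + 1 ≤ 2 * m + 9 := by omega
        have h3 := Nat.mul_le_mul_right (p + 1) hu
        nlinarith
      · rw [show 2 * u / 2 = u by omega, not_le] at hc
        obtain ⟨d, hd⟩ : ∃ d, p = u + d + (r + 5 + lam - 2) * u + 1 :=
          ⟨p - (u + (r + 5 + lam - 2) * u + 1), by omega⟩
        have hd0 : 0 < d := by omega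
        have hud : u + d ≤ 2 * m + 8 := by
          rw [show r + 5 + lam - 2 = r + 3 + lam by omega] at hd
          have := Nat.mul_le_mul_left (r + 3 + lam) hu1
          nlinarith
        have hdu : d ≤ u := by omega
        have hpair : ∀ i ∈ range (u + 1 - d),
            p * (b (d + i) + b (d + (u - d - i))) + q ≤ (p + 2) * q := by
          intro i hi
          rw [mem_range] at hi
          have := htup 2 (by omega) (by omega)
            (fun j => if j = 0 then d + i else d + (u - d - i))
            (fun j _ => by split_ifs <;> omega) (by
              simp only [sum_range_succ, sum_range_zero]
              norm_num
              omega)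
          simpa [sum_range_succ] using this.le
        have h1 := sum_le_sum hpair
        rw [sum_add_distrib, ← mul_sum, sum_add_distrib,
          sum_range_comp_eq (b := fun i => b (d + i)) (f := fun i => u - d - i)
            (by intros; omega) (by intros; omega)] at h1
        simp only [sum_const, card_range, smul_eq_mul] at h1
        have h2 : ∑ i ∈ range d, b i ≤ d * q := by
          simpa using sum_le_card_nsmul (range d) b q (fun i _ => hbq i)
        have h3 : ∑ i ∈ range (u + 1), b i =
            ∑ i ∈ range d, b i + ∑ i ∈ range (u + 1 - d), b (d + i) := by
          rw [← sum_range_add]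
          congr 2
          omega
        obtain ⟨e, he⟩ : ∃ e, u + 1 = d + e := ⟨u + 1 - d, by omega⟩
        rw [show u + 1 - d = e by omega] at h1 h3
        have h4 : (m + 5) * q ≤ d * q + ∑ i ∈ range e, b (d + i) := by omega
        have h5 := Nat.mul_le_mul_left (2 * p) h4
        have h6 : (2 * p * (m + 5)) * q ≤ (2 * p * d + e * (p + 1)) * q := by nlinarith
        have h7 := Nat.le_of_mul_le_mul_right h6 hq
        nlinarith

lemma sum_range_mem_itSum {G : Type*} [AddCommMonoid G] {A : Set G} (a : ℕ → G) (h : ℕ)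
    (ha : ∀ j < h, a j ∈ A) : ∑ j ∈ Finset.range h, a j ∈ itSum h A := by
  induction h with
  | zero => simp [itSum]
  | succ h ih =>
    rw [Finset.sum_range_succ]
    exact Set.add_mem_add (ih fun j hj => ha j (by omega)) (ha h (by omega))

/-- (Weight dichotomy, `λ ≤ k+ℓ-5`.) If `m ≥ 5`, then for every
decomposition, either `ω(A) ≤ m+1` or `ω(A) > p - θ` with `θ = k+ℓ+λ+2`. -/
theorem stmt15 (k l n m lam p : ℕ) (hlk : l < k) (hl : 1 ≤ l) (hn : 1 ≤ n) (hm : 5 ≤ m)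
    (hlam : (lam : ℤ) ≤ (k : ℤ) + l - 5)
    (hp : p = (k + l) * m + 2 + lam) (hpp : p.Prime)
    (A : Set (Fin n → ZMod p)) (hA : A.Nonempty) (hfree : KLFree k l A)
    (hcard : m * p ^ (n - 1) ≤ A.ncard)
    (v : Fin n → ZMod p) (K : Submodule (ZMod p) (Fin n → ZMod p))
    (hK : Module.finrank (ZMod p) K = n - 1) (hv : v ∉ K) :
    weight v K A ≤ m + 1 ∨ p - (k + l + lam + 2) < weight v K A := by
  by_contra hcon
  push Not at hcon
  obtain ⟨hw1, hw2⟩ := hcon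
  classical
  have : Fact p.Prime := ⟨hpp⟩
  have : Fintype K := Fintype.ofFinite K
  have hq : Fintype.card K = p ^ (n - 1) := by
    rw [Module.card_eq_pow_finrank (K := ZMod p), ZMod.card, hK]
  set B : ZMod p → Finset K := fun i => Finset.univ.filter fun x => (x : Fin n → ZMod p) + i • v ∈ A
    with hB
  have hmemB : ∀ i (x : K), x ∈ B i ↔ (x : Fin n → ZMod p) + i • v ∈ A := by simp [hB]
  set W : Finset (ZMod p) := Finset.univ.filter fun i => (B i).Nonempty with hW
  have hweight : weight v K A = W.card := by
    rw [weight, ← Set.ncard_coe_finset]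
    congr 1
    ext i
    simp only [supp, layerKL, hW, Finset.coe_filter, Finset.mem_univ, true_and, Set.mem_ofPred_eq]
    constructor
    · rintro ⟨x, hx, hxA⟩
      exact ⟨⟨x, hx⟩, (hmemB _ _).2 hxA⟩
    · rintro ⟨x, hx⟩
      exact ⟨x, x.2, (hmemB _ _).1 hx⟩
  have hinj : Function.Injective fun y : ZMod p × K => (y.2 : Fin n → ZMod p) + y.1 • v := by
    rintro ⟨i, x⟩ ⟨j, y⟩ hxy
    dsimp only at hxy
    have hij : (i - j) • v ∈ K := by
      have : (i - j) • v = (y : Fin n → ZMod p) - x := by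
        rw [sub_smul, sub_eq_sub_iff_add_eq_add, add_comm, hxy]
      rw [this]
      exact K.sub_mem y.2 x.2
    have h0 : i = j := by
      by_contra hne
      exact hv ((K.smul_mem_iff (sub_ne_zero.2 hne)).1 hij)
    subst h0
    simpa using hxy
  have hbij := (Fintype.bijective_iff_injective_and_card _).2 ⟨hinj, by
    rw [Fintype.card_prod, hq, ZMod.card, Fintype.card_fun, ZMod.card, Fintype.card_fin,
      ← pow_succ', Nat.sub_add_cancel hn]⟩
  have hAB : A.ncard ≤ ∑ i, (B i).card := by
    have hsub : A ⊆ ((Finset.univ.biUnion fun i =>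
        (B i).image fun x : K => (x : Fin n → ZMod p) + i • v : Finset (Fin n → ZMod p)) :
        Set (Fin n → ZMod p)) := by
      intro a ha
      obtain ⟨⟨i, x⟩, rfl⟩ := hbij.2 a
      simp only [Finset.coe_biUnion, Finset.coe_image, Set.mem_iUnion]
      exact ⟨i, by simp, x, (hmemB i x).2 ha, rfl⟩
    refine (Set.ncard_le_ncard hsub (Finset.finite_toSet _)).trans ?_
    rw [Set.ncard_coe_finset]
    exact Finset.card_biUnion_le.trans (Finset.sum_le_sum fun i _ => Finset.card_image_le)
  obtain ⟨u, hu⟩ : ∃ u, W.card = u + 1 := ⟨W.card - 1, by omega⟩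
  obtain ⟨σ, hσ, hσW, hanti⟩ := exists_sorted_enumeration (fun i => (B i).card) 0 _ W hu
  have himg : (Finset.range (u + 1)).image σ = W := by
    apply Finset.eq_of_subset_of_card_le
    · intro y hy
      obtain ⟨t, ht, rfl⟩ := Finset.mem_image.1 hy
      exact hσW t (Finset.mem_range.1 ht)
    · rw [Finset.card_image_of_injOn hσ, Finset.card_range, hu]
  have hbsum : ∑ i ∈ Finset.range (u + 1), (B (σ i)).card = ∑ i, (B i).card := by
    rw [← Finset.sum_image hσ (f := fun i => (B i).card), himg]
    apply Finset.sum_subset (Finset.subset_univ _)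
    intro i _ hi
    simpa [hW, Finset.not_nonempty_iff_eq_empty] using hi
  refine no_intermediate_weight (p := p) (q := Fintype.card K) (r := k + l) (u := u) (m := m)
    (lam := lam) (b := fun i => (B (σ i)).card) (by omega) hm hp Fintype.card_pos (by omega) ?_
    (fun i => Finset.card_le_univ _) ?_ ?_
  · obtain ⟨m, rfl⟩ : ∃ m', m = m' + 1 := ⟨m - 1, by omega⟩
    rw [mul_add_one] at hp
    rw [Nat.add_sub_cancel]
    omega
  · rw [hq, hbsum]
    exact hcard.trans hAB
  · intro s hs hsr idx hidx hlarge
    set C : ℕ → ZMod p → Finset K := fun j i => if j < k then B i else -B (-i) with hC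
    set ix : ℕ → ℕ := fun j => if j < s then idx j else u with hix
    have hixu : ∀ j, ix j ≤ u := by
      intro j
      by_cases h : j < s
      · simpa [hix, h] using hidx j h
      · simp [hix, h]
    set X : ℕ → Finset (ZMod p) := fun j =>
      if j < k then (Finset.range (ix j + 1)).image σ
      else -(Finset.range (ix j + 1)).image σ with hX
    have hXcard : ∀ j, (X j).card = ix j + 1 := by
      intro j
      have h1 : ((Finset.range (ix j + 1)).image σ).card = ix j + 1 := by
        rw [Finset.card_image_of_injOn, Finset.card_range]
        refine hσ.mono ?_
        have := hixu j
        intro t ht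
        simp only [Finset.coe_range, Set.mem_Iio] at ht ⊢
        omega
      by_cases h : j < k
      · simpa [hX, h] using h1
      · simpa [hX, h] using h1
    have hXmem : ∀ j, ∀ i ∈ X j, ∃ t ≤ ix j, (C j i).card = (B (σ t)).card := by
      intro j i hi
      by_cases h : j < k
      · simp only [hX, h, if_true, Finset.mem_image, Finset.mem_range] at hi
        obtain ⟨t, ht, rfl⟩ := hi
        exact ⟨t, by omega, by simp [hC, h]⟩
      · simp only [hX, h, if_false, Finset.mem_neg, Finset.mem_image, Finset.mem_range] at hi
        obtain ⟨_, ⟨t, ht, rfl⟩, rfl⟩ := hi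
        exact ⟨t, by omega, by simp [hC, h]⟩
    have key := layer_sizes_of_zero_sum_free (G := K) hs hsr C ?_ X
      (fun j => (B (σ (ix j))).card) ?_ ?_ ?_ ?_
    · convert key using 3
      refine Finset.sum_congr rfl fun j hj => ?_
      simp [hix, Finset.mem_range.1 hj]
    · intro f x hx hf0 hx0
      have hpos : ∀ j < k, (x j : Fin n → ZMod p) + f j • v ∈ A := by
        intro j hj
        have := hx j (by omega)
        simpa only [hC, hj, if_true, hmemB] using this
      have hneg : ∀ j < l, -((x (k + j) : Fin n → ZMod p) + f (k + j) • v) ∈ A := by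
        intro j hj
        have := hx (k + j) (by omega)
        have hjk : ¬ k + j < k := by omega
        simp only [hC, hjk, if_false, Finset.mem_neg'] at this
        have h2 := (hmemB _ _).1 this
        simpa [neg_add, add_comm] using h2
      have h1 := sum_range_mem_itSum _ k hpos
      have h2 := sum_range_mem_itSum _ l hneg
      have h3 : ∑ j ∈ Finset.range (k + l), ((x j : Fin n → ZMod p) + f j • v) = 0 := by
        rw [Finset.sum_add_distrib, ← Finset.sum_smul, hf0, zero_smul, add_zero,
          ← K.coe_sum, hx0, K.coe_zero]
      rw [Finset.sum_range_add, ← eq_neg_iff_add_eq_zero, ← Finset.sum_neg_distrib] at h3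
      have : (∑ j ∈ Finset.range k, ((x j : Fin n → ZMod p) + f j • v)) ∈
          itSum k A ∩ itSum l A := ⟨h1, h3 ▸ h2⟩
      rw [KLFree] at hfree
      rw [hfree] at this
      exact this
    · intro j _
      exact Finset.card_pos.1 (by rw [hXcard]; omega)
    · intro j _ i hi
      obtain ⟨t, ht, htc⟩ := hXmem j i hi
      have h1 := hσW t (by have := hixu j; omega)
      rw [hW, Finset.mem_filter] at h1
      exact Finset.card_pos.1 (htc ▸ Finset.card_pos.2 h1.2)
    · intro j _ i hi
      obtain ⟨t, ht, htc⟩ := hXmem j i hi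
      rw [htc]
      exact hanti t (ix j) ht (by have := hixu j; omega)
    · simp only [hXcard]
      rw [Finset.sum_add_distrib, ← Finset.sum_range_add_sum_Ico _ hsr]
      rw [Finset.sum_congr rfl (fun j hj => if_pos (Finset.mem_range.1 hj)),
        Finset.sum_congr rfl (fun j hj => if_neg (not_lt.2 (Finset.mem_Ico.1 hj).1))]
      simp only [Finset.sum_const, Nat.card_Ico, Finset.card_range, smul_eq_mul, mul_one]
      change p + (k + l) ≤ (∑ j ∈ Finset.range s, idx j) + (k + l - s) * u + (k + l) + 1
      omega
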